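/- Let F be a linearly closed differential field with constants C of characteristic zero, and K(∂) a skewadjoint ℓ×ℓ matrix differential operator over F of order N with invertible leading coefficient K_N. Then the C-bilinear form ⟨·|·⟩_K restricted to Z = ker(K(∂)) ⊆ F^ℓ (which takes values in C, is symmetric, and where dim_C Z = Nℓ) is nondegenerate. -/

import Mathlib

/-- Application of the matrix differential operator `K(∂)` to a vector. -/
def applyOp {F : Type} [Field F] (d : F → F) {ℓ N : ℕ}
    (K : Fin (N + 1) → Matrix (Fin ℓ) (Fin ℓ) F) (v : Fin ℓ → F) : Fin ℓ → F :=
  fun i => ∑ n : Fin (N + 1), ∑ j, K n i j * d^[(n : ℕ)] (v j)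

/-- The pairing `⟨F|G⟩_K`. -/
def pairingK {F : Type} [Field F] (d : F → F) {ℓ N : ℕ}
    (K : Fin (N + 1) → Matrix (Fin ℓ) (Fin ℓ) F) (Fv Gv : Fin ℓ → F) : F :=
  ∑ i, ∑ j, ∑ n : Fin (N + 1), ∑ m ∈ Finset.range (n : ℕ),
    ((n : ℕ).choose m : F) * (-1 : F) ^ ((n : ℕ) - 1 - m) *
      d^[(n : ℕ) - 1 - m] (Fv i * K n i j * d^[m] (Gv j))

/-- The coefficients of the adjoint operator `K*`. -/
def adjCoeff {F : Type} [Field F] (d : F → F) {ℓ N : ℕ}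
    (K : Fin (N + 1) → Matrix (Fin ℓ) (Fin ℓ) F) :
    Fin (N + 1) → Matrix (Fin ℓ) (Fin ℓ) F :=
  fun m => Matrix.of fun i j =>
    ∑ n : Fin (N + 1),
      if (m : ℕ) ≤ (n : ℕ) then
        ((n : ℕ).choose (m : ℕ) : F) * (-1 : F) ^ (n : ℕ) * d^[(n : ℕ) - (m : ℕ)] (K n j i)
      else 0


namespace S19

section ext
variable {F : Type} [Field F] (δ : F →+ F)
  {V : Type} [AddCommGroup V] [Module F V] (D : V →+ V)

theorem ext_step [Module.Finite F V]
    (hδ : ∀ a b, δ (a * b) = δ a * b + a * δ b)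
    (hD : ∀ (a : F) (v : V), D (a • v) = δ a • v + a • D v)
    (hLC : ∀ (n : ℕ) (a : Fin (n + 1) → F) (b : F), a (Fin.last n) ≠ 0 →
      (∃ u : F, ∑ k : Fin (n + 1), a k * δ^[(k : ℕ)] u = b) ∧
      (1 ≤ n → ∃ u : F, u ≠ 0 ∧ ∑ k : Fin (n + 1), a k * δ^[(k : ℕ)] u = 0))
    (S : Submodule F V) (φ : V →ₗ[F] F)
    (hS : ∀ s ∈ S, D s ∈ S ∧ φ (D s) = δ (φ s)) (v : V) (hv : v ∉ S) :
    ∃ (S' : Submodule F V) (φ' : V →ₗ[F] F), S ≤ S' ∧ v ∈ S' ∧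
      (∀ s ∈ S, φ' s = φ s) ∧ (∀ s ∈ S', D s ∈ S' ∧ φ' (D s) = δ (φ' s)) ∧
      (S = ⊥ → φ' v ≠ 0) := by
  classical
  let fam : (r : ℕ) → Fin r → V ⧸ S := fun r i => S.mkQ (D^[(i : ℕ)] v)
  have hex : ∃ r, ¬ LinearIndependent F (fam r) := by
    refine ⟨Module.finrank F (V ⧸ S) + 1, fun h => ?_⟩
    have := h.fintype_card_le_finrank
    simp at this
  obtain ⟨r, hr, hr1⟩ : ∃ r, LinearIndependent F (fam r) ∧ ¬ LinearIndependent F (fam (r+1)) := by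
    by_contra! hcon
    obtain ⟨r, hr⟩ := hex
    apply hr
    clear hr
    induction r with
    | zero => exact linearIndependent_empty_type
    | succ k ih => exact hcon k ih
  have hmem : S.mkQ (D^[r] v) ∈ Submodule.span F (Set.range (fam r)) := by
    by_contra hn
    apply hr1
    have := linearIndependent_finSnoc.2 ⟨hr, hn⟩
    have e : fam (r + 1) = Fin.snoc (fam r) (S.mkQ (D^[r] v)) := by
      funext i
      refine Fin.lastCases ?_ (fun i => ?_) i
      · simp [fam]
      · simp [fam]
    rw [e]
    exact this
  have hrpos : 1 ≤ r := by
    rcases Nat.eq_zero_or_pos r with h0 | h0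
    · subst h0
      simp at hmem
      exact absurd hmem hv
    · exact h0
  obtain ⟨c, hc⟩ := (Submodule.mem_span_range_iff_exists_fun F).1 hmem
  set s : V := D^[r] v - ∑ i : Fin r, c i • D^[(i:ℕ)] v with hs
  have hsS : s ∈ S := by
    rw [← Submodule.Quotient.mk_eq_zero, ← Submodule.mkQ_apply, hs, map_sub, map_sum, ← hc]
    simp [fam]
  obtain ⟨u, hu, hu0⟩ : ∃ u : F, δ^[r] u - ∑ i : Fin r, c i * δ^[(i:ℕ)] u = φ s ∧ (S = ⊥ → u ≠ 0) := by
    have key := hLC r (Fin.snoc (fun i => - c i) 1) (φ s) (by simp)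
    by_cases hb : S = ⊥
    · obtain ⟨u, hu0, hu⟩ := key.2 hrpos
      refine ⟨u, ?_, fun _ => hu0⟩
      have : s = 0 := by rw [hb] at hsS; simpa using hsS
      rw [this, map_zero, ← hu, Fin.sum_univ_castSucc]
      simp [Finset.sum_neg_distrib]
      ring
    · obtain ⟨u, hu⟩ := key.1
      refine ⟨u, ?_, fun h => absurd h hb⟩
      rw [← hu, Fin.sum_univ_castSucc]
      simp [Finset.sum_neg_distrib]
      ring
  obtain ⟨ψ, hψ⟩ : ∃ ψ : (V ⧸ S) →ₗ[F] F, ∀ i : Fin r, ψ (fam r i) = δ^[(i:ℕ)] u - φ (D^[(i:ℕ)] v) := by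
    let b := Module.Basis.span hr
    obtain ⟨ψ, hψ⟩ := LinearMap.exists_extend (b.constr F (fun i : Fin r => δ^[(i:ℕ)] u - φ (D^[(i:ℕ)] v)))
    refine ⟨ψ, fun i => ?_⟩
    have h2 := LinearMap.congr_fun hψ (b i)
    rw [Module.Basis.constr_basis] at h2
    rw [← h2]
    simp [b, Module.Basis.span_apply]
  set φ' : V →ₗ[F] F := φ + ψ ∘ₗ S.mkQ with hφ'
  have h1 : ∀ s ∈ S, φ' s = φ s := by
    intro s hs
    simp [hφ', (Submodule.Quotient.mk_eq_zero S).2 hs]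
  have h2 : ∀ i < r, φ' (D^[i] v) = δ^[i] u := by
    intro i hi
    have := hψ ⟨i, hi⟩
    simp only [fam] at this
    simp only [hφ', LinearMap.add_apply, LinearMap.comp_apply, this]
    ring
  have h2r : φ' (D^[r] v) = δ^[r] u := by
    have : D^[r] v = s + ∑ i : Fin r, c i • D^[(i:ℕ)] v := by rw [hs]; abel
    rw [this, map_add, h1 s hsS, map_sum, ← hu]
    simp [h2]
  set S' : Submodule F V := S ⊔ Submodule.span F (Set.range fun i : Fin r => D^[(i:ℕ)] v) with hS'
  have hmS' : ∀ i < r, D^[i] v ∈ S' := fun i hi =>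
    (le_sup_right : _ ≤ S') (Submodule.subset_span ⟨⟨i, hi⟩, rfl⟩)
  have hmr : D^[r] v ∈ S' := by
    have : D^[r] v = s + ∑ i : Fin r, c i • D^[(i:ℕ)] v := by rw [hs]; abel
    rw [this]
    exact S'.add_mem ((le_sup_left : S ≤ S') hsS)
      (S'.sum_mem fun i _ => S'.smul_mem _ (hmS' i i.2))
  let T : Submodule F V :=
    { carrier := {w | w ∈ S' ∧ D w ∈ S' ∧ φ' (D w) = δ (φ' w)}
      zero_mem' := by simp
      add_mem' := by
        rintro a b ⟨ha, ha1, ha2⟩ ⟨hb, hb1, hb2⟩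
        refine ⟨S'.add_mem ha hb, ?_, ?_⟩
        · rw [map_add]; exact S'.add_mem ha1 hb1
        · simp [ha2, hb2]
      smul_mem' := by
        rintro a w ⟨ha, ha1, ha2⟩
        refine ⟨S'.smul_mem _ ha, ?_, ?_⟩
        · rw [hD]; exact S'.add_mem (S'.smul_mem _ ha) (S'.smul_mem _ ha1)
        · simp [hD, hδ, ha2] }
  have hT : S' ≤ T := by
    refine sup_le (fun w hw => ?_) (Submodule.span_le.2 ?_)
    · obtain ⟨ha, hb⟩ := hS w hw
      exact ⟨(le_sup_left : S ≤ S') hw, (le_sup_left : S ≤ S') ha, by rw [h1 _ ha, hb, h1 _ hw]⟩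
    · rintro _ ⟨i, rfl⟩
      refine ⟨hmS' i i.2, ?_, ?_⟩
      · change D (D^[(i:ℕ)] v) ∈ S'
        rw [← Function.iterate_succ_apply' D]
        rcases Nat.lt_or_ge (i+1) r with h | h
        · exact hmS' _ h
        · have : (i:ℕ).succ = r := by have := i.2; omega
          rw [this]; exact hmr
      · change φ' (D (D^[(i:ℕ)] v)) = δ (φ' (D^[(i:ℕ)] v))
        rw [← Function.iterate_succ_apply' D, h2 i i.2, ← Function.iterate_succ_apply' δ]
        rcases Nat.lt_or_ge (i+1) r with h | h
        · exact h2 _ h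
        · have : (i:ℕ).succ = r := by have := i.2; omega
          rw [this]; exact h2r
  refine ⟨S', φ', le_sup_left, hmS' 0 hrpos, h1, fun w hw => (hT hw).2, fun hb => ?_⟩
  have := h2 0 hrpos
  simp at this
  rw [this]
  exact hu0 hb

theorem ext_all [Module.Finite F V]
    (hδ : ∀ a b, δ (a * b) = δ a * b + a * δ b)
    (hD : ∀ (a : F) (v : V), D (a • v) = δ a • v + a • D v)
    (hLC : ∀ (n : ℕ) (a : Fin (n + 1) → F) (b : F), a (Fin.last n) ≠ 0 →
      (∃ u : F, ∑ k : Fin (n + 1), a k * δ^[(k : ℕ)] u = b) ∧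
      (1 ≤ n → ∃ u : F, u ≠ 0 ∧ ∑ k : Fin (n + 1), a k * δ^[(k : ℕ)] u = 0))
    (S : Submodule F V) : ∀ (φ : V →ₗ[F] F)
    (_ : ∀ s ∈ S, D s ∈ S ∧ φ (D s) = δ (φ s)),
    ∃ (φ' : V →ₗ[F] F), (∀ s ∈ S, φ' s = φ s) ∧ (∀ s, φ' (D s) = δ (φ' s)) := by
  induction S using WellFoundedGT.induction with
  | ind S ih =>
    intro φ hS
    by_cases h : S = ⊤
    · exact ⟨φ, fun _ _ => rfl, fun s => (hS s (h ▸ Submodule.mem_top)).2⟩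
    · obtain ⟨v, hv⟩ : ∃ v, v ∉ S := by
        by_contra! hc
        exact h (Submodule.eq_top_iff'.2 hc)
      obtain ⟨S', φ', hle, hvS, hag, hc, -⟩ := ext_step δ D hδ hD hLC S φ hS v hv
      obtain ⟨φ2, ha, hb⟩ := ih S' (lt_of_le_of_ne hle (fun h => hv (h ▸ hvS))) φ' hc
      exact ⟨φ2, fun s hs => (ha s (hle hs)).trans (hag s hs), hb⟩

theorem exists_sol [Module.Finite F V]
    (hδ : ∀ a b, δ (a * b) = δ a * b + a * δ b)
    (hD : ∀ (a : F) (v : V), D (a • v) = δ a • v + a • D v)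
    (hLC : ∀ (n : ℕ) (a : Fin (n + 1) → F) (b : F), a (Fin.last n) ≠ 0 →
      (∃ u : F, ∑ k : Fin (n + 1), a k * δ^[(k : ℕ)] u = b) ∧
      (1 ≤ n → ∃ u : F, u ≠ 0 ∧ ∑ k : Fin (n + 1), a k * δ^[(k : ℕ)] u = 0))
    (v : V) (hv : v ≠ 0) :
    ∃ (φ : V →ₗ[F] F), φ v ≠ 0 ∧ (∀ s, φ (D s) = δ (φ s)) := by
  obtain ⟨S', φ', -, hvS, -, hc, h0⟩ := ext_step δ D hδ hD hLC ⊥ 0 (by simp) v (by simpa using hv)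
  obtain ⟨φ2, ha, hb⟩ := ext_all δ D hδ hD hLC S' φ' hc
  exact ⟨φ2, by rw [ha v hvS]; exact h0 rfl, hb⟩

end ext

section poly
open MvPolynomial

/-- trilinear evaluation of symbols -/
noncomputable def ev {F : Type} [Field F] (δ : F →+ F) (f k g : F) :
    MvPolynomial (Fin 3) ℤ →ₗ[ℤ] F :=
  (MvPolynomial.basisMonomials (Fin 3) ℤ).constr ℤ
    (fun s => δ^[s 0] f * δ^[s 1] k * δ^[s 2] g)

variable {F : Type} [Field F] (δ : F →+ F)

theorem ev_monomial (f k g : F) (s : Fin 3 →₀ ℕ) :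
    ev δ f k g (monomial s 1) = δ^[s 0] f * δ^[s 1] k * δ^[s 2] g := by
  have := (MvPolynomial.basisMonomials (Fin 3) ℤ).constr_basis ℤ
    (fun s => δ^[s 0] f * δ^[s 1] k * δ^[s 2] g) s
  simpa [ev] using this

theorem ev_ext {A B : MvPolynomial (Fin 3) ℤ →ₗ[ℤ] F}
    (h : ∀ s, A (monomial s 1) = B (monomial s 1)) : A = B := by
  apply (MvPolynomial.basisMonomials (Fin 3) ℤ).ext
  intro s
  simpa using h s

theorem ev_one (f k g : F) : ev δ f k g 1 = f * k * g := by
  have := ev_monomial δ f k g 0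
  simpa using this

theorem ev_X0 (f k g : F) (p) : ev δ f k g (X 0 * p) = ev δ (δ f) k g p := by
  have : ev δ f k g ∘ₗ LinearMap.mulLeft ℤ (X 0) = ev δ (δ f) k g := by
    apply ev_ext
    intro s
    simp only [LinearMap.comp_apply, LinearMap.mulLeft_apply, X, monomial_mul, mul_one, ev_monomial]
    simp [add_comm 1, Function.iterate_succ_apply]
  exact LinearMap.congr_fun this p

theorem ev_X1 (f k g : F) (p) : ev δ f k g (X 1 * p) = ev δ f (δ k) g p := by
  have : ev δ f k g ∘ₗ LinearMap.mulLeft ℤ (X 1) = ev δ f (δ k) g := by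
    apply ev_ext
    intro s
    simp only [LinearMap.comp_apply, LinearMap.mulLeft_apply, X, monomial_mul, mul_one, ev_monomial]
    simp [add_comm 1, Function.iterate_succ_apply]
  exact LinearMap.congr_fun this p

theorem ev_X2 (f k g : F) (p) : ev δ f k g (X 2 * p) = ev δ f k (δ g) p := by
  have : ev δ f k g ∘ₗ LinearMap.mulLeft ℤ (X 2) = ev δ f k (δ g) := by
    apply ev_ext
    intro s
    simp only [LinearMap.comp_apply, LinearMap.mulLeft_apply, X, monomial_mul, mul_one, ev_monomial]
    simp [add_comm 1, Function.iterate_succ_apply]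
  exact LinearMap.congr_fun this p

theorem ev_S (hδ : ∀ a b, δ (a * b) = δ a * b + a * δ b) (f k g : F) (p) :
    ev δ f k g ((X 0 + X 1 + X 2) * p) = δ (ev δ f k g p) := by
  have : ev δ f k g ∘ₗ LinearMap.mulLeft ℤ (X 0 + X 1 + X 2) = δ.toIntLinearMap ∘ₗ ev δ f k g := by
    apply ev_ext
    intro s
    simp only [LinearMap.comp_apply, LinearMap.mulLeft_apply, add_mul, map_add, ev_X0, ev_X1, ev_X2,
      ev_monomial, AddMonoidHom.coe_toIntLinearMap, hδ, ← Function.iterate_succ_apply,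
      ← Function.iterate_succ_apply' δ]
    try ring
  exact LinearMap.congr_fun this p

theorem ev_mon (f k g : F) (a b c : ℕ) :
    ev δ f k g (X 0 ^ a * (X 1 ^ b * X 2 ^ c)) = δ^[a] f * δ^[b] k * δ^[c] g := by
  have := ev_monomial δ f k g (Finsupp.single 0 a + (Finsupp.single 1 b + Finsupp.single 2 c))
  rw [X_pow_eq_monomial, X_pow_eq_monomial, X_pow_eq_monomial, monomial_mul, monomial_mul,
    mul_one, mul_one, this]
  simp

theorem ev_Spow (hδ : ∀ a b, δ (a * b) = δ a * b + a * δ b) (f k g : F) (n : ℕ) (p) :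
    ev δ f k g ((X 0 + X 1 + X 2) ^ n * p) = δ^[n] (ev δ f k g p) := by
  induction n with
  | zero => simp
  | succ n ih => rw [pow_succ', mul_assoc, ev_S δ hδ, ih, Function.iterate_succ_apply' δ]

theorem ev_hpow (hδ : ∀ a b, δ (a * b) = δ a * b + a * δ b) (f k g : F) (a c : ℕ) :
    ev δ f k g ((X 0 + X 1) ^ a * X 2 ^ c) = δ^[a] (f * k) * δ^[c] g := by
  induction a generalizing f k with
  | zero => simpa using ev_mon δ f k g 0 0 c
  | succ n ih =>
    rw [pow_succ', mul_assoc, add_mul, map_add, ev_X0, ev_X1, ih, ih, Function.iterate_succ_apply,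
      hδ, iterate_map_add, add_mul]

theorem ev_int (f k g : F) (c : ℤ) (p) : ev δ f k g ((c : MvPolynomial (Fin 3) ℤ) * p) = (c : F) * ev δ f k g p := by
  rw [← zsmul_eq_mul, map_zsmul, zsmul_eq_mul]

/-- symbol -/
noncomputable def Apoly {R : Type} [CommRing R] (n : ℕ) (S y : R) : R :=
  ∑ m ∈ Finset.range n, (n.choose m : R) * (-1) ^ (n - 1 - m) * (S ^ (n - 1 - m) * y ^ m)

theorem S_mul_Apoly {R : Type} [CommRing R] (n : ℕ) (S y : R) :
    S * Apoly n S y = y ^ n - (y - S) ^ n := by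
  have h := add_pow y (-S) n
  rw [Finset.sum_range_succ] at h
  simp only [Nat.sub_self, pow_zero, Nat.choose_self, Nat.cast_one, mul_one] at h
  rw [sub_eq_add_neg y S, h, Apoly, Finset.mul_sum]
  rw [sub_add_eq_sub_sub_swap, sub_self, zero_sub, ← Finset.sum_neg_distrib]
  refine Finset.sum_congr rfl fun m hm => ?_
  have : n - m = (n - 1 - m) + 1 := by have := Finset.mem_range.1 hm; omega
  rw [this, pow_succ (-S), neg_pow S]
  ring

theorem S_ne : (X 0 + X 1 + X 2 : MvPolynomial (Fin 3) ℤ) ≠ 0 := by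
  intro h
  have := congrArg (eval (fun _ => (1:ℤ))) h
  simp at this

/-- the pairing term -/
def At (n : ℕ) (h g : F) : F :=
  ∑ m ∈ Finset.range n, (n.choose m : F) * (-1 : F) ^ (n - 1 - m) * δ^[n - 1 - m] (h * δ^[m] g)

theorem At_eq_ev (hδ : ∀ a b, δ (a * b) = δ a * b + a * δ b) (n : ℕ) (f k g : F) :
    At δ n (f * k) g = ev δ f k g (Apoly n (X 0 + X 1 + X 2) (X 2)) := by
  rw [At, Apoly, map_sum]
  refine Finset.sum_congr rfl fun m _ => ?_
  have := ev_int δ f k g (n.choose m * (-1) ^ (n - 1 - m))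
    ((X 0 + X 1 + X 2) ^ (n - 1 - m) * X 2 ^ m)
  push_cast at this
  rw [this, ev_Spow δ hδ]
  have := ev_mon δ f k g 0 0 m
  simp at this
  rw [this]

theorem At_eq_ev' (hδ : ∀ a b, δ (a * b) = δ a * b + a * δ b) (n b : ℕ) (f k g : F) :
    At δ n (g * δ^[b] k) f = ev δ f k g (X 1 ^ b * Apoly n (X 0 + X 1 + X 2) (X 0)) := by
  rw [At, Apoly, Finset.mul_sum, map_sum]
  refine Finset.sum_congr rfl fun m _ => ?_
  have := ev_int δ f k g (n.choose m * (-1) ^ (n - 1 - m))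
    ((X 0 + X 1 + X 2) ^ (n - 1 - m) * (X 0 ^ m * (X 1 ^ b * X 2 ^ 0)))
  push_cast at this
  rw [ev_Spow δ hδ, ev_mon] at this
  rw [show δ^[n - 1 - m] (g * δ^[b] k * δ^[m] f) = δ^[n - 1 - m] (δ^[m] f * δ^[b] k * δ^[0] g) by
    congr 1; simp; ring]
  rw [← this]
  congr 1
  ring

theorem At_eq_B (hδ : ∀ a b, δ (a * b) = δ a * b + a * δ b) (n : ℕ) (f k g : F) :
    At δ n (f * k) g = ∑ m ∈ Finset.range n, (-1 : F) ^ (n - 1 - m) * δ^[n - 1 - m] (f * k) * δ^[m] g := by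
  have hp : (Apoly n (X 0 + X 1 + X 2) (X 2) : MvPolynomial (Fin 3) ℤ) =
      ∑ m ∈ Finset.range n, (((-1) ^ (n - 1 - m) : ℤ) : MvPolynomial (Fin 3) ℤ) * ((X 0 + X 1) ^ (n - 1 - m) * X 2 ^ m) := by
    apply mul_left_cancel₀ S_ne
    rw [S_mul_Apoly]
    have := (Commute.all (X 2 : MvPolynomial (Fin 3) ℤ) (-(X 0 + X 1))).mul_geom_sum₂ n
    rw [show (X 2 - (X 0 + X 1 + X 2) : MvPolynomial (Fin 3) ℤ) = -(X 0 + X 1) by ring, ← this]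
    rw [show (X 2 - -(X 0 + X 1) : MvPolynomial (Fin 3) ℤ) = X 0 + X 1 + X 2 by ring]
    congr 1
    refine Finset.sum_congr rfl fun m _ => ?_
    rw [neg_pow]
    push_cast
    ring
  rw [At_eq_ev δ hδ, hp, map_sum]
  refine Finset.sum_congr rfl fun m _ => ?_
  rw [ev_int, ev_hpow δ hδ]
  push_cast
  ring

theorem d_At (hδ : ∀ a b, δ (a * b) = δ a * b + a * δ b) (n : ℕ) (f k g : F) :
    δ (At δ n (f * k) g) = f * k * δ^[n] g - (-1) ^ n * δ^[n] (f * k) * g := by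
  rw [At_eq_ev δ hδ, ← ev_S δ hδ, S_mul_Apoly, map_sub]
  rw [show (X 2 - (X 0 + X 1 + X 2) : MvPolynomial (Fin 3) ℤ) = -(X 0 + X 1) by ring, neg_pow]
  have h1 := ev_hpow δ hδ f k g 0 n
  have h2 := ev_hpow δ hδ f k g n 0
  have h3 := ev_int δ f k g ((-1) ^ n) ((X 0 + X 1) ^ n)
  push_cast at h3
  simp at h1 h2
  rw [h3, h1, h2]
  ring

theorem At_symm (hδ : ∀ a b, δ (a * b) = δ a * b + a * δ b) (n : ℕ) (f k g : F) :
    ∑ m ∈ Finset.range (n + 1), (n.choose m : F) * (-1) ^ n * At δ m (g * δ^[n - m] k) f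
      = - At δ n (f * k) g := by
  have hp : ∑ m ∈ Finset.range (n + 1), ((n.choose m * (-1) ^ n : ℤ) : MvPolynomial (Fin 3) ℤ) *
      (X 1 ^ (n - m) * Apoly m (X 0 + X 1 + X 2) (X 0)) = - Apoly n (X 0 + X 1 + X 2) (X 2) := by
    apply mul_left_cancel₀ S_ne
    rw [mul_neg, S_mul_Apoly, Finset.mul_sum]
    have e : ∀ m ∈ Finset.range (n + 1), (X 0 + X 1 + X 2) * (((n.choose m * (-1) ^ n : ℤ) : MvPolynomial (Fin 3) ℤ) *
      (X 1 ^ (n - m) * Apoly m (X 0 + X 1 + X 2) (X 0))) =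
      (-1) ^ n * (X 0 ^ m * X 1 ^ (n - m) * (n.choose m : MvPolynomial (Fin 3) ℤ)) -
      (-1) ^ n * ((-(X 1 + X 2)) ^ m * X 1 ^ (n - m) * (n.choose m : MvPolynomial (Fin 3) ℤ)) := by
      intro m _
      have := S_mul_Apoly m (X 0 + X 1 + X 2 : MvPolynomial (Fin 3) ℤ) (X 0)
      rw [show (X 0 - (X 0 + X 1 + X 2) : MvPolynomial (Fin 3) ℤ) = -(X 1 + X 2) by ring] at this
      push_cast
      linear_combination ((n.choose m : MvPolynomial (Fin 3) ℤ) * (-1) ^ n * X 1 ^ (n - m)) * this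
    rw [Finset.sum_congr rfl e, Finset.sum_sub_distrib, ← Finset.mul_sum, ← Finset.mul_sum,
      ← add_pow, ← add_pow, ← mul_pow, ← mul_pow]
    ring
  rw [At_eq_ev δ hδ, ← map_neg, ← hp, map_sum]
  refine Finset.sum_congr rfl fun m _ => ?_
  rw [ev_int, At_eq_ev' δ hδ]
  push_cast
  ring


theorem leib (hδ : ∀ a b, δ (a * b) = δ a * b + a * δ b) (n : ℕ) (f k : F) :
    δ^[n] (f * k) = ∑ m ∈ Finset.range (n + 1), (n.choose m : F) * (δ^[m] f * δ^[n - m] k) := by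
  have h := ev_hpow δ hδ f k 1 n 0
  simp only [pow_zero, mul_one, Function.iterate_zero, id] at h
  rw [← h, add_pow, map_sum]
  refine Finset.sum_congr rfl fun m _ => ?_
  have h3 := ev_int δ f k 1 (n.choose m) (X 0 ^ m * (X 1 ^ (n - m) * X 2 ^ 0))
  rw [ev_mon] at h3
  push_cast at h3
  simp only [pow_zero, mul_one, Function.iterate_zero, id] at h3
  rw [← h3]
  congr 1
  ring

end poly

section main
variable {F : Type} [Field F] (δ : F →+ F)

theorem adj_sum {ℓ N : ℕ} (K : Fin (N + 1) → Matrix (Fin ℓ) (Fin ℓ) F) (T : ℕ → F →+ F)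
    (i j : Fin ℓ) :
    ∑ m : Fin (N + 1), T m (adjCoeff δ K m j i) =
      ∑ n : Fin (N + 1), ∑ m ∈ Finset.range (n + 1),
        ((n : ℕ).choose m : F) * (-1) ^ (n : ℕ) * T m (δ^[(n : ℕ) - m] (K n i j)) := by
  simp only [adjCoeff, Matrix.of_apply, map_sum]
  rw [Finset.sum_comm]
  refine Finset.sum_congr rfl fun n _ => ?_
  rw [Fin.sum_univ_eq_sum_range (fun m => T m (if m ≤ (n : ℕ) then
        ((n : ℕ).choose m : F) * (-1 : F) ^ (n : ℕ) * δ^[(n : ℕ) - m] (K n i j)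
      else 0)) (N + 1)]
  symm
  have hsub : Finset.range ((n : ℕ) + 1) ⊆ Finset.range (N + 1) := by
    intro m hm
    have := n.2
    simp only [Finset.mem_range] at *
    omega
  rw [← Finset.sum_subset hsub]
  · refine Finset.sum_congr rfl fun m hm => ?_
    have hm' : m ≤ n := by simp only [Finset.mem_range] at hm; omega
    rw [if_pos hm']
    have := map_zsmul (T m) ((n : ℕ).choose m * (-1) ^ (n : ℕ) : ℤ) (δ^[(n : ℕ) - m] (K n i j))
    rw [zsmul_eq_mul, zsmul_eq_mul] at this
    push_cast at this
    exact this.symm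
  · intro m _ hm
    have hm' : ¬ m ≤ n := by simp only [Finset.mem_range] at hm; omega
    rw [if_neg hm', map_zero]

theorem At_add (n : ℕ) (a b g : F) : At δ n (a + b) g = At δ n a g + At δ n b g := by
  simp only [At, ← Finset.sum_add_distrib, add_mul, iterate_map_add, mul_add]

theorem pairing_eq {ℓ N : ℕ} (K : Fin (N + 1) → Matrix (Fin ℓ) (Fin ℓ) F) (f g : Fin ℓ → F) :
    pairingK δ K f g = ∑ i, ∑ j, ∑ n : Fin (N + 1), At δ n (f i * K n i j) (g j) := rfl

theorem pairing_symm (hδ : ∀ a b, δ (a * b) = δ a * b + a * δ b)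
    {ℓ N : ℕ} (K : Fin (N + 1) → Matrix (Fin ℓ) (Fin ℓ) F)
    (hskew : ∀ n, adjCoeff δ K n = -(K n)) (f g : Fin ℓ → F) :
    pairingK δ K f g = pairingK δ K g f := by
  rw [pairing_eq, pairing_eq, Finset.sum_comm]
  refine Finset.sum_congr rfl fun j _ => Finset.sum_congr rfl fun i _ => ?_
  let T : ℕ → F →+ F := fun m => AddMonoidHom.mk' (fun x => At δ m (g j * x) (f i))
    (fun a b => by rw [mul_add, At_add])
  have h := adj_sum δ K T i j
  simp only [hskew, Matrix.neg_apply, map_neg, Finset.sum_neg_distrib] at h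
  have h2 : ∀ n : Fin (N + 1), ∑ m ∈ Finset.range ((n : ℕ) + 1),
        ((n : ℕ).choose m : F) * (-1) ^ (n : ℕ) * T m (δ^[(n : ℕ) - m] (K n i j)) =
        - At δ n (f i * K n i j) (g j) := fun n => At_symm δ hδ n (f i) (K n i j) (g j)
  simp only [h2, Finset.sum_neg_distrib, neg_inj] at h
  exact h.symm

theorem d_pairing (hδ : ∀ a b, δ (a * b) = δ a * b + a * δ b)
    {ℓ N : ℕ} (K : Fin (N + 1) → Matrix (Fin ℓ) (Fin ℓ) F)
    (hskew : ∀ n, adjCoeff δ K n = -(K n)) (f g : Fin ℓ → F) :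
    δ (pairingK δ K f g) = ∑ i, f i * applyOp δ K g i + ∑ j, g j * applyOp δ K f j := by
  rw [pairing_eq]
  simp only [map_sum, d_At δ hδ, Finset.sum_sub_distrib]
  rw [sub_eq_add_neg]
  congr 1
  · refine Finset.sum_congr rfl fun i _ => ?_
    rw [Finset.sum_comm]
    simp only [applyOp, Finset.mul_sum, mul_assoc]
  · rw [Finset.sum_comm, ← Finset.sum_neg_distrib]
    refine Finset.sum_congr rfl fun j _ => ?_
    rw [applyOp, Finset.sum_comm, Finset.mul_sum, Finset.sum_comm, ← Finset.sum_neg_distrib]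
    simp only [Finset.mul_sum]
    conv_rhs => rw [Finset.sum_comm]
    refine Finset.sum_congr rfl fun i _ => ?_
    have h := adj_sum δ K (fun m => AddMonoidHom.mulLeft (δ^[m] (f i))) i j
    simp only [hskew, Matrix.neg_apply, map_neg, Finset.sum_neg_distrib,
      AddMonoidHom.coe_mulLeft] at h
    have h2 : ∀ n : Fin (N + 1), (-1) ^ (n : ℕ) * δ^[(n : ℕ)] (f i * K n i j) * g j =
        g j * ∑ m ∈ Finset.range ((n : ℕ) + 1),
        ((n : ℕ).choose m : F) * (-1) ^ (n : ℕ) * (δ^[m] (f i) * δ^[(n : ℕ) - m] (K n i j)) := by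
      intro n
      rw [leib δ hδ, Finset.mul_sum, Finset.mul_sum, Finset.sum_mul]
      exact Finset.sum_congr rfl fun m _ => by ring
    simp only [h2]
    rw [← Finset.mul_sum, ← h, mul_neg, neg_neg, Finset.mul_sum]
    exact Finset.sum_congr rfl fun m _ => by ring

/-- coefficients of the operator `P_F` -/
def coef {ℓ N : ℕ} (K : Fin (N + 1) → Matrix (Fin ℓ) (Fin ℓ) F) (f : Fin ℓ → F)
    (m : ℕ) (j : Fin ℓ) : F :=
  ∑ i, ∑ n : Fin (N + 1), if m < (n : ℕ) then
    (-1 : F) ^ ((n : ℕ) - 1 - m) * δ^[(n : ℕ) - 1 - m] (f i * K n i j) else 0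

theorem pairing_coef (hδ : ∀ a b, δ (a * b) = δ a * b + a * δ b)
    {ℓ N : ℕ} (K : Fin (N + 1) → Matrix (Fin ℓ) (Fin ℓ) F) (f g : Fin ℓ → F) :
    pairingK δ K f g = ∑ m : Fin N, ∑ j, coef δ K f m j * δ^[(m : ℕ)] (g j) := by
  have h : ∀ i j (n : Fin (N + 1)), At δ n (f i * K n i j) (g j) =
      ∑ m : Fin N, (if (m : ℕ) < (n : ℕ) then
        (-1 : F) ^ ((n : ℕ) - 1 - m) * δ^[(n : ℕ) - 1 - m] (f i * K n i j) else 0) *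
          δ^[(m : ℕ)] (g j) := by
    intro i j n
    rw [At_eq_B δ hδ, Fin.sum_univ_eq_sum_range (fun m => (if m < (n : ℕ) then
        (-1 : F) ^ ((n : ℕ) - 1 - m) * δ^[(n : ℕ) - 1 - m] (f i * K n i j) else 0) *
          δ^[m] (g j)) N]
    have hsub : Finset.range (n : ℕ) ⊆ Finset.range N := by
      intro m hm
      have := n.2
      simp only [Finset.mem_range] at *
      omega
    rw [← Finset.sum_subset hsub]
    · refine Finset.sum_congr rfl fun m hm => ?_
      rw [if_pos (Finset.mem_range.1 hm)]
    · intro m _ hm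
      rw [if_neg (fun h => hm (Finset.mem_range.2 h)), zero_mul]
  rw [pairing_eq]
  simp only [h, coef, Finset.sum_mul]
  calc _ = ∑ j, ∑ i, ∑ m : Fin N, ∑ n : Fin (N + 1), (if (m : ℕ) < (n : ℕ) then
        (-1 : F) ^ ((n : ℕ) - 1 - m) * δ^[(n : ℕ) - 1 - m] (f i * K n i j) else 0) *
          δ^[(m : ℕ)] (g j) := by
        rw [Finset.sum_comm]
        exact Finset.sum_congr rfl fun j _ => Finset.sum_congr rfl fun i _ => Finset.sum_comm
    _ = ∑ j, ∑ m : Fin N, ∑ i, ∑ n : Fin (N + 1), (if (m : ℕ) < (n : ℕ) then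
        (-1 : F) ^ ((n : ℕ) - 1 - m) * δ^[(n : ℕ) - 1 - m] (f i * K n i j) else 0) *
          δ^[(m : ℕ)] (g j) := Finset.sum_congr rfl fun j _ => Finset.sum_comm
    _ = _ := Finset.sum_comm

theorem coef_last {ℓ N : ℕ} (K : Fin (N + 2) → Matrix (Fin ℓ) (Fin ℓ) F) (f : Fin ℓ → F)
    (j : Fin ℓ) : coef δ K f N j = Matrix.vecMul f (K (Fin.last (N + 1))) j := by
  rw [coef, Matrix.vecMul, dotProduct]
  refine Finset.sum_congr rfl fun i _ => ?_
  rw [Finset.sum_eq_single (Fin.last (N + 1))]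
  · simp
  · intro n _ hn
    have : (n : ℕ) ≠ N + 1 := fun h => hn (Fin.ext (by simpa using h))
    rw [if_neg]
    have := n.2
    omega
  · simp

/-- images of the basis vectors -/
noncomputable def tgt {ℓ N : ℕ} (K : Fin (N + 2) → Matrix (Fin ℓ) (Fin ℓ) F)
    (p : Fin (N + 1) × Fin ℓ) : Fin (N + 1) × Fin ℓ → F :=
  if h : (p.1 : ℕ) + 1 < N + 1 then Pi.single (⟨(p.1 : ℕ) + 1, h⟩, p.2) 1
  else fun q => - ∑ i, (K (Fin.last (N + 1)))⁻¹ p.2 i * K q.1.castSucc i q.2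

/-- the connection -/
noncomputable def conn {ℓ N : ℕ} (K : Fin (N + 2) → Matrix (Fin ℓ) (Fin ℓ) F) :
    (Fin (N + 1) × Fin ℓ → F) →+ (Fin (N + 1) × Fin ℓ → F) :=
  AddMonoidHom.mk' (fun c q => δ (c q) + ∑ p, c p * tgt K p q) (by
    intro a b
    funext q
    simp only [Pi.add_apply, map_add, add_mul, Finset.sum_add_distrib]
    ring)

theorem conn_smul (hδ : ∀ a b, δ (a * b) = δ a * b + a * δ b)
    {ℓ N : ℕ} (K : Fin (N + 2) → Matrix (Fin ℓ) (Fin ℓ) F) (a : F)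
    (v : Fin (N + 1) × Fin ℓ → F) :
    conn δ K (a • v) = δ a • v + a • conn δ K v := by
  funext q
  simp only [conn, AddMonoidHom.mk'_apply, Pi.add_apply, Pi.smul_apply, smul_eq_mul, hδ, mul_add,
    Finset.mul_sum, mul_assoc, add_assoc]

theorem conn_single (hδ : ∀ a b, δ (a * b) = δ a * b + a * δ b)
    {ℓ N : ℕ} (K : Fin (N + 2) → Matrix (Fin ℓ) (Fin ℓ) F) (p : Fin (N + 1) × Fin ℓ) :
    conn δ K (Pi.single p 1) = tgt K p := by
  have h1 : δ 1 = 0 := by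
    have := hδ 1 1
    simpa using this
  funext q
  have : δ ((Pi.single p 1 : Fin (N + 1) × Fin ℓ → F) q) = 0 := by
    by_cases h : q = p
    · subst h; simpa using h1
    · simp [Pi.single_eq_of_ne h]
  simp only [conn, AddMonoidHom.mk'_apply, this, zero_add]
  rw [Finset.sum_eq_single p]
  · simp
  · intro b _ hb
    simp [Pi.single_eq_of_ne hb]
  · simp

theorem nondeg (hδ : ∀ a b, δ (a * b) = δ a * b + a * δ b)
    (hLC : ∀ (n : ℕ) (a : Fin (n + 1) → F) (b : F), a (Fin.last n) ≠ 0 →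
      (∃ u : F, ∑ k : Fin (n + 1), a k * δ^[(k : ℕ)] u = b) ∧
      (1 ≤ n → ∃ u : F, u ≠ 0 ∧ ∑ k : Fin (n + 1), a k * δ^[(k : ℕ)] u = 0))
    {ℓ N : ℕ} (K : Fin (N + 2) → Matrix (Fin ℓ) (Fin ℓ) F)
    (hKN : IsUnit (K (Fin.last (N + 1)))) (f : Fin ℓ → F)
    (h : ∀ g : Fin ℓ → F, applyOp δ K g = 0 → pairingK δ K f g = 0) : f = 0 := by
  have hdet := (Matrix.isUnit_iff_isUnit_det _).1 hKN
  set c : Fin (N + 1) × Fin ℓ → F := fun p => coef δ K f p.1 p.2 with hc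
  by_cases hc0 : c = 0
  · have h1 : Matrix.vecMul f (K (Fin.last (N + 1))) = 0 := by
      funext j
      rw [← coef_last δ]
      have := congrFun hc0 (Fin.last N, j)
      simpa [hc] using this
    have h2 := congrArg (fun v => Matrix.vecMul v (K (Fin.last (N + 1)))⁻¹) h1
    simpa [Matrix.vecMul_vecMul, Matrix.mul_nonsing_inv _ hdet] using h2
  · exfalso
    obtain ⟨φ, hφc, hφ⟩ := exists_sol δ (conn δ K) hδ (conn_smul δ hδ K) hLC c hc0
    let g : Fin ℓ → F := fun j => φ (Pi.single (0, j) 1)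
    have hg : ∀ (m : ℕ) (hm : m < N + 1) (j : Fin ℓ),
        δ^[m] (g j) = φ (Pi.single (⟨m, hm⟩, j) 1) := by
      intro m
      induction m with
      | zero => intro hm j; rfl
      | succ m ih =>
        intro hm j
        rw [Function.iterate_succ_apply' δ, ih (by omega) j, ← hφ, conn_single δ hδ, tgt, dif_pos hm]
    have hφs : ∀ v : Fin (N + 1) × Fin ℓ → F,
        φ v = ∑ m : Fin (N + 1), ∑ j, v (m, j) * δ^[(m : ℕ)] (g j) := by
      intro v
      rw [LinearMap.pi_apply_eq_sum_univ φ v, Fintype.sum_prod_type]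
      refine Finset.sum_congr rfl fun m _ => Finset.sum_congr rfl fun j _ => ?_
      rw [hg m m.2 j, smul_eq_mul]
      congr 2
      funext q
      simp [Pi.single_apply, eq_comm]
    let w : Fin ℓ → F := fun i => ∑ m : Fin (N + 1), ∑ j, K m.castSucc i j * δ^[(m : ℕ)] (g j)
    have hgN : (fun j => δ^[N + 1] (g j)) = - Matrix.mulVec (K (Fin.last (N + 1)))⁻¹ w := by
      funext j
      rw [Function.iterate_succ_apply' δ, hg N (by omega) j, ← hφ, conn_single δ hδ, tgt,
        dif_neg (by simp), hφs]
      simp only [Pi.neg_apply, Matrix.mulVec, dotProduct, w, neg_mul, Finset.sum_neg_distrib,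
        Finset.mul_sum, Finset.sum_mul]
      congr 1
      rw [Finset.sum_comm' (t' := Finset.univ) (s' := fun _ => Finset.univ) (by simp)]
      conv_rhs => rw [Finset.sum_comm]
      conv_lhs => rw [Finset.sum_comm]
      refine Finset.sum_congr rfl fun m _ => ?_
      rw [Finset.sum_comm]
      exact Finset.sum_congr rfl fun i _ => Finset.sum_congr rfl fun j' _ => by ring
    have happ : applyOp δ K g = 0 := by
      have : applyOp δ K g = w + Matrix.mulVec (K (Fin.last (N + 1))) (fun j => δ^[N + 1] (g j)) := by
        funext i
        rw [applyOp, Fin.sum_univ_castSucc]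
        rfl
      rw [this, hgN, Matrix.mulVec_neg, Matrix.mulVec_mulVec, Matrix.mul_nonsing_inv _ hdet]
      simp
    apply hφc
    rw [hφs, ← h g happ, pairing_coef δ hδ]

end main
end S19

/-- let `F` be a linearly closed differential field with constants of
characteristic zero, and `K(∂)` a skewadjoint ℓ×ℓ matrix differential operator of
order `N` with invertible leading coefficient.  Then the bilinear form `⟨·|·⟩_K`
restricted to `Z = ker K(∂) ⊆ F^ℓ` takes values in the constants, is symmetric,
and is nondegenerate. -/
theorem stmt_19 {F : Type} [Field F] [CharZero F] (d : F → F)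
    (hd_add : ∀ a b, d (a + b) = d a + d b)
    (hd_mul : ∀ a b, d (a * b) = d a * b + a * d b)
    (hLC : ∀ (n : ℕ) (a : Fin (n + 1) → F) (b : F), a (Fin.last n) ≠ 0 →
      (∃ u : F, ∑ k : Fin (n + 1), a k * d^[(k : ℕ)] u = b) ∧
      (1 ≤ n → ∃ u : F, u ≠ 0 ∧ ∑ k : Fin (n + 1), a k * d^[(k : ℕ)] u = 0))
    (ℓ N : ℕ)
    (K : Fin (N + 1) → Matrix (Fin ℓ) (Fin ℓ) F)
    (hskew : ∀ n, adjCoeff d K n = -(K n))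
    (hKN : IsUnit (K (Fin.last N))) :
    (∀ Fv Gv : Fin ℓ → F, applyOp d K Fv = 0 → applyOp d K Gv = 0 →
        d (pairingK d K Fv Gv) = 0 ∧ pairingK d K Fv Gv = pairingK d K Gv Fv) ∧
    (∀ Fv : Fin ℓ → F, applyOp d K Fv = 0 →
      (∀ Gv : Fin ℓ → F, applyOp d K Gv = 0 → pairingK d K Fv Gv = 0) →
      Fv = 0) := by
  obtain ⟨δ, rfl⟩ : ∃ δ : F →+ F, ⇑δ = d := ⟨AddMonoidHom.mk' d hd_add, rfl⟩
  refine ⟨fun f g hf hg => ⟨?_, S19.pairing_symm δ hd_mul K hskew f g⟩, fun f hf h => ?_⟩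
  · rw [S19.d_pairing δ hd_mul K hskew, hf, hg]
    simp
  · cases N with
    | succ N => exact S19.nondeg δ hd_mul hLC K hKN f h
    | zero =>
      have hdet := (Matrix.isUnit_iff_isUnit_det _).1 hKN
      have h1 : Matrix.mulVec (K (Fin.last 0)) f = 0 := by
        rw [← hf]
        funext i
        simp [applyOp, Matrix.mulVec, dotProduct]
      have h2 := congrArg (Matrix.mulVec (K (Fin.last 0))⁻¹) h1
      rw [Matrix.mulVec_mulVec, Matrix.nonsing_inv_mul _ hdet] at h2
      simpa using h2
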